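/- The infinite series ∑_{k=1}^∞ ( 9H_{k+1}²/((k+1)²) - 15H_{k+2}²/((k+2)²) + 7H_{k+3}²/((k+3)²) ) converges and equals 287/324 + (17/4)·ζ(4). -/

import Mathlib

/-- `harm k` is the `k`-th harmonic number `H_k = 1 + 1/2 + ⋯ + 1/k`. -/
noncomputable def harm (k : ℕ) : ℝ := ∑ i ∈ Finset.range k, (1 : ℝ) / (i + 1)

/-- `zeta m = ∑_{k=1}^∞ 1/k^m`, the Riemann zeta function at a natural argument. -/
noncomputable def zeta (m : ℕ) : ℝ := ∑' n : ℕ, (1 : ℝ) / (n + 1) ^ m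

open Filter Topology Finset

/-- The generalized harmonic number `1 + 1/2² + ⋯ + 1/n²`. -/
noncomputable def harmSq (n : ℕ) : ℝ := ∑ i ∈ range n, (1 : ℝ) / (i + 1) ^ 2

/-- The second elementary symmetric function of `1, 1/2, …, 1/n`. -/
noncomputable def harmPair (n : ℕ) : ℝ := ∑ i ∈ range n, harm i / (i + 1)

/-- The connector `n! m! / (n + m)!`. -/
noncomputable def connector (n m : ℕ) : ℝ :=
  (n.factorial : ℝ) * m.factorial / (n + m).factorial

lemma harm_succ (n : ℕ) : harm (n + 1) = harm n + 1 / (n + 1) := sum_range_succ _ n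

lemma harmSq_succ (n : ℕ) : harmSq (n + 1) = harmSq n + 1 / (n + 1) ^ 2 := sum_range_succ _ n

lemma harmPair_succ (n : ℕ) : harmPair (n + 1) = harmPair n + harm n / (n + 1) :=
  sum_range_succ _ n

lemma harm_nonneg (n : ℕ) : 0 ≤ harm n := sum_nonneg fun _ _ => by positivity

lemma harmPair_nonneg (n : ℕ) : 0 ≤ harmPair n :=
  sum_nonneg fun i _ => div_nonneg (harm_nonneg i) (by positivity)

lemma harmSq_nonneg (n : ℕ) : 0 ≤ harmSq n := sum_nonneg fun _ _ => by positivity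

lemma harm_sq_eq (n : ℕ) : harm n ^ 2 = 2 * harmPair n + harmSq n := by
  induction n with
  | zero => simp [harm, harmPair, harmSq]
  | succ n ih =>
    rw [harm_succ, harmPair_succ, harmSq_succ, add_sq, ih]
    field_simp
    ring

lemma harm_le_one_add_log (n : ℕ) : harm n ≤ 1 + Real.log n := by
  have h := harmonic_le_one_add_log n
  have e : ((harmonic n : ℚ) : ℝ) = harm n := by
    simp [harmonic, harm]
  rwa [e] at h

lemma connector_comm (n m : ℕ) : connector n m = connector m n := by
  unfold connector
  rw [add_comm n m, mul_comm]

lemma connector_nonneg (n m : ℕ) : 0 ≤ connector n m := by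
  unfold connector
  positivity

lemma connector_zero_left (m : ℕ) : connector 0 m = 1 := by
  have : (m.factorial : ℝ) ≠ 0 := by positivity
  simp [connector, this]

lemma connector_succ_right (n m : ℕ) :
    connector n (m + 1) = connector n m * ((m + 1) / (n + m + 1)) := by
  unfold connector
  rw [← add_assoc, Nat.factorial_succ, Nat.factorial_succ]
  push_cast
  have : ((n + m).factorial : ℝ) ≠ 0 := by positivity
  have : (n + m + 1 : ℝ) ≠ 0 := by positivity
  field_simp

lemma connector_succ_left (n m : ℕ) :
    connector (n + 1) m = connector n m * ((n + 1) / (n + m + 1)) := by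
  rw [connector_comm, connector_succ_right, connector_comm m n, add_comm (m : ℝ)]

/-- The telescoping identity behind the connected-sum method. -/
lemma connector_succ_div (n m : ℕ) :
    connector (n + 1) (m + 1) / (n + 1)
      = (connector n (m + 1) - connector (n + 1) (m + 1)) / (m + 1) := by
  rw [connector_succ_left]
  push_cast
  have : (n + (m + 1) + 1 : ℝ) ≠ 0 := by positivity
  field_simp
  ring

lemma connector_succ_le (n m : ℕ) : connector n (m + 1) ≤ 1 / (n + 1) := by
  induction m with
  | zero =>
    rw [connector_succ_right, connector_comm, connector_zero_left]
    simp
  | succ m ih =>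
    rw [connector_succ_right]
    refine (mul_le_of_le_one_right (connector_nonneg _ _) ?_).trans ih
    rw [div_le_one (by positivity)]
    have : (0 : ℝ) ≤ n := by positivity
    linarith

lemma tendsto_mul_connector_zero {f : ℕ → ℝ} (h0 : ∀ n, 0 ≤ f n)
    (h : ∀ n, f n ≤ (1 + Real.log n) ^ 2) (m : ℕ) :
    Tendsto (fun n => f n * connector n (m + 1)) atTop (𝓝 0) := by
  have hlog : Tendsto (fun x : ℝ => (1 + Real.log x) ^ 2 / x) atTop (𝓝 0) := by
    have h1 := Real.tendsto_pow_log_div_mul_add_atTop 1 0 1 one_ne_zero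
    have h2 := Real.tendsto_pow_log_div_mul_add_atTop 1 0 2 one_ne_zero
    have h3 := tendsto_inv_atTop_zero (𝕜 := ℝ)
    have := (h3.add (h1.const_mul 2)).add h2
    simp only [mul_zero, add_zero] at this
    refine this.congr fun x => ?_
    simp only [div_eq_mul_inv, one_mul]
    ring
  refine squeeze_zero' (Eventually.of_forall fun n => mul_nonneg (h0 n) (connector_nonneg _ _)) ?_
    (hlog.comp tendsto_natCast_atTop_atTop)
  filter_upwards [eventually_gt_atTop 0] with n hn
  have hn' : (0 : ℝ) < n := by exact_mod_cast hn
  rw [Function.comp, div_eq_mul_inv]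
  refine mul_le_mul (h n) ((connector_succ_le n m).trans ?_) (connector_nonneg _ _) (sq_nonneg _)
  rw [one_div]
  exact inv_anti₀ hn' (by linarith)

/-- Summation by parts against the connector. -/
lemma hasSum_connector_step {f g : ℕ → ℝ} (hg0 : ∀ n, 0 ≤ g n)
    (hg : ∀ n, g (n + 1) = g n + f n / (n + 1)) (hlog : ∀ n, g n ≤ (1 + Real.log n) ^ 2)
    {m : ℕ} {s : ℝ} (hf : HasSum (fun n : ℕ => f n * (connector (n + 1) (m + 1) / (n + 1))) s) :
    HasSum (fun n : ℕ => g n * (connector (n + 1) (m + 1) / (n + 1))) ((g 0 + s) / (m + 1)) := by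
  have key : ∀ N : ℕ, ∑ n ∈ range N, g n * (connector (n + 1) (m + 1) / (n + 1))
      = (g 0 + ∑ n ∈ range N, f n * (connector (n + 1) (m + 1) / (n + 1))
          - g N * connector N (m + 1)) / (m + 1) := by
    intro N
    induction N with
    | zero => simp [connector_zero_left]
    | succ N ih =>
      rw [sum_range_succ, sum_range_succ, ih, hg, connector_succ_div]
      have h := connector_succ_div N m
      have hm : (m + 1 : ℝ) ≠ 0 := by positivity
      have hN : (N + 1 : ℝ) ≠ 0 := by positivity
      field_simp at h ⊢
      linear_combination f N * h
  rw [hasSum_iff_tendsto_nat_of_nonneg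
    (fun n => mul_nonneg (hg0 n) (div_nonneg (connector_nonneg _ _) (by positivity)))]
  simp only [key]
  have := ((hf.tendsto_sum_nat.const_add (g 0)).sub
    (tendsto_mul_connector_zero hg0 hlog m)).div_const (m + 1 : ℝ)
  simpa using this

lemma one_le_one_add_log_natCast (n : ℕ) : 1 ≤ 1 + Real.log n :=
  le_add_of_nonneg_right (Real.log_natCast_nonneg n)

lemma hasSum_connector (m : ℕ) :
    HasSum (fun n : ℕ => connector (n + 1) (m + 1) / (n + 1)) (1 / (m + 1)) := by
  have := hasSum_connector_step (f := fun _ => 0) (g := fun _ => 1) (m := m) (s := 0)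
    (fun _ => zero_le_one) (by simp) (fun n => one_le_pow₀ (one_le_one_add_log_natCast n))
    (by simp)
  simpa using this

lemma hasSum_harm_mul_connector (m : ℕ) :
    HasSum (fun n : ℕ => harm n * (connector (n + 1) (m + 1) / (n + 1))) (1 / (m + 1) ^ 2) := by
  have := hasSum_connector_step (f := fun _ => 1) (g := harm) (m := m) (s := 1 / (m + 1))
    harm_nonneg harm_succ
    (fun n => (harm_le_one_add_log n).trans
      (le_self_pow₀ (one_le_one_add_log_natCast n) two_ne_zero))
    (by simpa using hasSum_connector m)
  convert! this using 1
  simp [harm]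
  field_simp

lemma hasSum_harmPair_mul_connector (m : ℕ) :
    HasSum (fun n : ℕ => harmPair n * (connector (n + 1) (m + 1) / (n + 1)))
      (1 / (m + 1) ^ 3) := by
  have := hasSum_connector_step (f := harm) (g := harmPair) (m := m)
    harmPair_nonneg harmPair_succ (fun n => ?_) (hasSum_harm_mul_connector m)
  · convert! this using 1
    simp [harmPair]
    field_simp
  · have h1 := harm_sq_eq n
    have h2 := pow_le_pow_left₀ (harm_nonneg n) (harm_le_one_add_log n) 2
    linarith [harmSq_nonneg n, harmPair_nonneg n]

lemma summable_one_div_add_one_pow {k : ℕ} (hk : 1 < k) :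
    Summable fun n : ℕ => (1 : ℝ) / (n + 1) ^ k := by
  have := (summable_nat_add_iff 1).2 (Real.summable_one_div_nat_pow.2 hk)
  simpa using this

lemma hasSum_zeta {k : ℕ} (hk : 1 < k) :
    HasSum (fun n : ℕ => (1 : ℝ) / (n + 1) ^ k) (zeta k) :=
  (summable_one_div_add_one_pow hk).hasSum

/-- The duality `ζ(2,1,1) = ζ(4)`. -/
lemma hasSum_harmPair_div_sq :
    HasSum (fun n : ℕ => harmPair n / (n + 1) ^ 2) (zeta 4) := by
  set F : ℕ × ℕ → ℝ := fun p =>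
    harmPair p.2 * (connector (p.2 + 1) (p.1 + 1) / (p.2 + 1)) * (1 / (p.1 + 1)) with hF
  have hrow : ∀ m, HasSum (fun n => F (m, n)) (1 / (m + 1) ^ 4) := by
    intro m
    convert! (hasSum_harmPair_mul_connector m).mul_right (1 / (m + 1 : ℝ)) using 1
    field_simp
  have hcol : ∀ n, HasSum (fun m => F (m, n)) (harmPair n / (n + 1) ^ 2) := by
    intro n
    convert! (hasSum_connector n).mul_left (harmPair n / (n + 1 : ℝ)) using 1
    · funext m
      simp only [hF]
      rw [connector_comm]
      ring
    · field_simp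
  have hF0 : 0 ≤ F := fun p => mul_nonneg (mul_nonneg (harmPair_nonneg _)
    (div_nonneg (connector_nonneg _ _) (by positivity))) (by positivity)
  have hsum : Summable F := by
    rw [summable_prod_of_nonneg hF0]
    refine ⟨fun m => (hrow m).summable, ?_⟩
    simp only [(hrow _).tsum_eq]
    exact summable_one_div_add_one_pow (by norm_num)
  have htotal : HasSum F (zeta 4) := by
    rw [(hasSum_zeta (by norm_num)).unique (hsum.hasSum.prod_fiberwise hrow)]
    exact hsum.hasSum
  exact ((Equiv.prodComm ℕ ℕ).hasSum_iff.2 htotal).prod_fiberwise hcol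

lemma sum_antidiagonal_fst_add_snd (u : ℕ → ℝ) (n : ℕ) :
    ∑ p ∈ antidiagonal n, (u p.1 + u p.2) = 2 * ∑ i ∈ range (n + 1), u i := by
  have h : ∑ p ∈ antidiagonal n, u p.1 = ∑ i ∈ range (n + 1), u i :=
    Nat.sum_antidiagonal_eq_sum_range_succ (fun i _ => u i) n
  have h' : ∑ p ∈ antidiagonal n, u p.2 = ∑ p ∈ antidiagonal n, u p.1 :=
    Nat.sum_antidiagonal_swap (f := fun p => u p.1)
  rw [sum_add_distrib, h', h]
  ring

lemma sum_antidiagonal_inv_sq_mul_inv_sq (n : ℕ) :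
    ∑ p ∈ antidiagonal n, (1 : ℝ) / (p.1 + 1) ^ 2 * (1 / (p.2 + 1) ^ 2)
      = 2 * harmSq (n + 1) / (n + 2) ^ 2 + 4 * harm (n + 1) / (n + 2) ^ 3 := by
  have h : ∀ p ∈ antidiagonal n, (1 : ℝ) / (p.1 + 1) ^ 2 * (1 / (p.2 + 1) ^ 2)
      = (1 / (p.1 + 1) ^ 2 + 1 / (p.2 + 1) ^ 2) * (1 / (n + 2) ^ 2)
        + (1 / (p.1 + 1) + 1 / (p.2 + 1)) * (2 / (n + 2) ^ 3) := by
    intro p hp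
    have hn : (n : ℝ) = p.1 + p.2 := by
      rw [← mem_antidiagonal.1 hp]
      push_cast
      ring
    rw [hn]
    have : (p.1 + p.2 + 2 : ℝ) ≠ 0 := by positivity
    field_simp
    ring
  rw [sum_congr rfl h, sum_add_distrib, ← sum_mul, ← sum_mul,
    sum_antidiagonal_fst_add_snd (fun i => (1 : ℝ) / (i + 1) ^ 2),
    sum_antidiagonal_fst_add_snd (fun i => (1 : ℝ) / (i + 1))]
  unfold harmSq harm
  ring

lemma zeta_two_sq : zeta 2 * zeta 2 = 5 / 2 * zeta 4 := by
  have h2 : HasSum (fun n : ℕ => (1 : ℝ) / (n + 1) ^ 2) (Real.pi ^ 2 / 6) := by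
    simpa using (hasSum_nat_add_iff' 1).2 hasSum_zeta_two
  have h4 : HasSum (fun n : ℕ => (1 : ℝ) / (n + 1) ^ 4) (Real.pi ^ 4 / 90) := by
    simpa using (hasSum_nat_add_iff' 1).2 hasSum_zeta_four
  rw [(hasSum_zeta (by norm_num)).unique h2, (hasSum_zeta (by norm_num)).unique h4]
  ring

/-- The shuffle relation `2 ζ(2,2) + 4 ζ(3,1) = ζ(2)²`, evaluated. -/
lemma hasSum_shuffle :
    HasSum (fun n : ℕ => 2 * harmSq n / (n + 1) ^ 2 + 4 * harm n / (n + 1) ^ 3)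
      (5 / 2 * zeta 4) := by
  have hs := summable_one_div_add_one_pow (k := 2) (by norm_num)
  have h := (summable_norm_sum_mul_antidiagonal_of_summable_norm hs.norm hs.norm).of_norm.hasSum
  rw [← tsum_mul_tsum_eq_tsum_sum_antidiagonal_of_summable_norm hs.norm hs.norm] at h
  change HasSum _ (zeta 2 * zeta 2) at h
  rw [zeta_two_sq] at h
  simp only [sum_antidiagonal_inv_sq_mul_inv_sq] at h
  rw [← hasSum_nat_add_iff' 1]
  convert! h using 1
  · funext n
    push_cast
    ring
  · simp [harmSq, harm]

lemma hasSum_harm_sq_div_sq :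
    HasSum (fun n : ℕ => harm (n + 1) ^ 2 / (n + 1) ^ 2) (17 / 4 * zeta 4) := by
  convert! ((hasSum_harmPair_div_sq.mul_left 2).add (hasSum_shuffle.mul_left (1 / 2))).add
    (hasSum_zeta (k := 4) (by norm_num)) using 1
  · funext n
    rw [harm_succ, add_sq, harm_sq_eq]
    field_simp
    ring
  · ring

theorem stmt_12 :
    HasSum (fun k : ℕ =>
      9 * harm (k + 2) ^ 2 / ((k : ℝ) + 2) ^ 2 - 15 * harm (k + 3) ^ 2 / ((k : ℝ) + 3) ^ 2
        + 7 * harm (k + 4) ^ 2 / ((k : ℝ) + 4) ^ 2)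
      (287 / 324 + (17 / 4) * zeta 4) := by
  have h1 := (hasSum_nat_add_iff' 1).2 hasSum_harm_sq_div_sq
  have h2 := (hasSum_nat_add_iff' 2).2 hasSum_harm_sq_div_sq
  have h3 := (hasSum_nat_add_iff' 3).2 hasSum_harm_sq_div_sq
  convert! ((h1.mul_left 9).sub (h2.mul_left 15)).add (h3.mul_left 7) using 1
  · funext k
    push_cast
    ring_nf
  · simp only [sum_range_succ, sum_range_zero, harm]
    push_cast
    ring
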